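/- arXiv:2512.14072 — 2 statements merged into one kernel-verified Lean document; each statement's English description precedes it below -/
import Mathlib

section
/- Fix μ_0 ∈ P(X_0) and μ_K ∈ P(X_K), and suppose M < ∞. Suppose moreover that there is a minimizing sequence {π_n} for M and a measurable function Φ : Ω → [0,∞] such that every sublevel set {ω ∈ Ω : Φ(ω) ≤ R} (R > 0) is compact and sup_n ∫_Ω Φ dπ_n < ∞. Then the infimum M is attained: there exist intermediate measures μ_1^*, …, μ_{K−1}^* with μ_k^* ∈ P(X̂_k) and an optimal coupling π^* ∈ Π(μ_0, μ_1^*, …, μ_{K−1}^*, μ_K) such that ∫_Ω c dπ^* = M. -/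
open MeasureTheory Filter Topology Set
open scoped ENNReal NNReal Classical

/-- The hierarchical-jump path cost: sum of `c i j (ω i) (ω j)` over consecutive pairs of
active indices of the path `ω` (a coordinate `k` is active when `ω k ∉ D k`, where `D k` is
the set consisting of the isolated point `∂ₖ`, empty for `k = 0, K`). -/
noncomputable def pathCost {K : ℕ} {Y : Fin (K + 1) → Type*} (D : ∀ k, Set (Y k))
    (c : ∀ i j : Fin (K + 1), Y i → Y j → ℝ≥0∞) (ω : ∀ k, Y k) : ℝ≥0∞ :=
  ∑ i : Fin (K + 1), ∑ j : Fin (K + 1),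
    if i < j ∧ ω i ∉ D i ∧ ω j ∉ D j ∧ ∀ m, i < m → m < j → ω m ∈ D m then
      c i j (ω i) (ω j)
    else 0

/-- The admissible couplings for the hierarchical jump problem: probability measures on
`Ω = ∏ k, X̂ₖ` with prescribed initial marginal `μ₀` and final marginal `μ_K` (the
intermediate marginals `μₖ = (Tₖ)_# π` are free, as they are optimized over in (2.1)). -/
def hjmotAdm {K : ℕ} {Y : Fin (K + 1) → Type*} [∀ k, MeasurableSpace (Y k)]
    (μ0 : Measure (Y 0)) (μK : Measure (Y (Fin.last K))) : Set (Measure (∀ k, Y k)) :=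
  {π | IsProbabilityMeasure π ∧ π.map (fun ω => ω 0) = μ0 ∧
    π.map (fun ω => ω (Fin.last K)) = μK}

/-- The optimal value `M` of the hierarchical jump multi-marginal transport problem. -/
noncomputable def hjmotValue {K : ℕ} {Y : Fin (K + 1) → Type*}
    [∀ k, MeasurableSpace (Y k)] (D : ∀ k, Set (Y k))
    (c : ∀ i j : Fin (K + 1), Y i → Y j → ℝ≥0∞)
    (μ0 : Measure (Y 0)) (μK : Measure (Y (Fin.last K))) : ℝ≥0∞ :=
  ⨅ π ∈ hjmotAdm μ0 μK, ∫⁻ ω, pathCost D c ω ∂π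

/-- Layer-cake formula for a truncated `[0, ∞]`-valued function. -/
lemma lintegral_min_natCast_eq_lintegral_meas_lt {α : Type*} [MeasurableSpace α]
    (μ : Measure α) {f : α → ℝ≥0∞} (hf : Measurable f) (n : ℕ) :
    ∫⁻ x, min (f x) n ∂μ = ∫⁻ t in Ioi (0 : ℝ), μ {x | ENNReal.ofReal t < min (f x) n} := by
  have hfin : ∀ x, min (f x) (n : ℝ≥0∞) ≠ ∞ := fun x =>
    ne_top_of_le_ne_top (ENNReal.natCast_ne_top n) (min_le_right _ _)
  have hlayer := lintegral_eq_lintegral_meas_lt μ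
    (f := fun x => (min (f x) (n : ℝ≥0∞)).toReal)
    (Eventually.of_forall fun x => ENNReal.toReal_nonneg)
    ((hf.min measurable_const).ennreal_toReal.aemeasurable)
  simp only [ENNReal.ofReal_toReal (hfin _)] at hlayer
  rw [hlayer]
  refine setLIntegral_congr_fun measurableSet_Ioi fun t ht => ?_
  simp only [← ENNReal.ofReal_lt_iff_lt_toReal (le_of_lt ht) (hfin _)]

/-- Lower semicontinuity of `μ ↦ ∫⁻ f ∂μ` for lower semicontinuous `f`, along a sequence
satisfying the liminf condition on open sets. -/
lemma LowerSemicontinuous.lintegral_le_liminf_lintegral {α : Type*} [TopologicalSpace α]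
    [MeasurableSpace α] [OpensMeasurableSpace α] {f : α → ℝ≥0∞} (hf : LowerSemicontinuous f)
    {μ : Measure α} {μs : ℕ → Measure α}
    (h_opens : ∀ G, IsOpen G → μ G ≤ atTop.liminf (fun i => μs i G)) :
    ∫⁻ x, f x ∂μ ≤ atTop.liminf (fun i => ∫⁻ x, f x ∂(μs i)) := by
  have hsup : ∀ x, f x = ⨆ n : ℕ, min (f x) n := fun x => by
    rw [← inf_iSup_eq, ENNReal.iSup_natCast, inf_top_eq]
  have hmono : Monotone fun (n : ℕ) x => min (f x) (n : ℝ≥0∞) := fun a b hab x =>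
    min_le_min_left _ (Nat.cast_le.2 hab)
  calc ∫⁻ x, f x ∂μ
      = ⨆ n : ℕ, ∫⁻ x, min (f x) n ∂μ := by
        rw [← lintegral_iSup (fun n => hf.measurable.min measurable_const) hmono]
        exact lintegral_congr hsup
    _ ≤ atTop.liminf (fun i => ∫⁻ x, f x ∂(μs i)) := iSup_le fun n => ?_
  calc ∫⁻ x, min (f x) n ∂μ
      = ∫⁻ t in Ioi (0 : ℝ), μ {x | ENNReal.ofReal t < min (f x) n} :=
        lintegral_min_natCast_eq_lintegral_meas_lt μ hf.measurable n
    _ ≤ ∫⁻ t in Ioi (0 : ℝ),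
          atTop.liminf (fun i => μs i {x | ENNReal.ofReal t < min (f x) n}) := by
        refine lintegral_mono fun t => h_opens _ ?_
        by_cases h : ENNReal.ofReal t < (n : ℝ≥0∞)
        · simp only [lt_min_iff, h, and_true]
          exact hf.isOpen_preimage (ENNReal.ofReal t)
        · simp [h]
    _ ≤ atTop.liminf (fun i =>
          ∫⁻ t in Ioi (0 : ℝ), μs i {x | ENNReal.ofReal t < min (f x) n}) :=
        lintegral_liminf_le fun i => Antitone.measurable fun s t hst => measure_mono
          fun x hx => (ENNReal.ofReal_le_ofReal hst).trans_lt hx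
    _ ≤ atTop.liminf (fun i => ∫⁻ x, f x ∂(μs i)) := by
        refine liminf_le_liminf (Eventually.of_forall fun i => ?_)
        simp only [← lintegral_min_natCast_eq_lintegral_meas_lt (μs i) hf.measurable n]
        exact lintegral_mono fun x => min_le_left _ _

/-- Measures with uniformly bounded integral of a function with compact sublevel sets are
tight. -/
lemma isTightMeasureSet_of_lintegral_le {α : Type*} [TopologicalSpace α] [MeasurableSpace α]
    {S : Set (Measure α)} {Φ : α → ℝ≥0∞} (hΦ : Measurable Φ)
    (hcomp : ∀ R : ℝ≥0, 0 < R → IsCompact {x | Φ x ≤ (R : ℝ≥0∞)})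
    {C : ℝ≥0∞} (hC : C ≠ ∞) (hS : ∀ μ ∈ S, ∫⁻ x, Φ x ∂μ ≤ C) : IsTightMeasureSet S := by
  rw [isTightMeasureSet_iff_exists_isCompact_measure_compl_le]
  intro ε hε
  obtain ⟨n, hn⟩ := ENNReal.exists_nat_mul_gt hε.ne' hC
  have hn0 : n ≠ 0 := by rintro rfl; simp at hn
  refine ⟨_, hcomp n (by positivity), fun μ hμ => ?_⟩
  have hsub : {x | Φ x ≤ ((n : ℝ≥0) : ℝ≥0∞)}ᶜ ⊆ {x | (n : ℝ≥0∞) ≤ Φ x} := fun x hx => by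
    simp only [mem_compl_iff, mem_ofPred_eq, not_le, ENNReal.coe_natCast] at hx
    exact hx.le
  have hle : (n : ℝ≥0∞) * μ {x | (n : ℝ≥0∞) ≤ Φ x} ≤ n * ε :=
    (mul_meas_ge_le_lintegral hΦ _).trans ((hS μ hμ).trans hn.le)
  exact (measure_mono hsub).trans
    ((ENNReal.mul_le_mul_iff_right (by simpa using hn0) (ENNReal.natCast_ne_top n)).1 hle)

lemma lowerSemicontinuous_pathCost {K : ℕ} {Y : Fin (K + 1) → Type*}
    [∀ k, TopologicalSpace (Y k)] {D : ∀ k, Set (Y k)}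
    (hDopen : ∀ k, IsOpen (D k)) (hDclosed : ∀ k, IsClosed (D k))
    {c : ∀ i j : Fin (K + 1), Y i → Y j → ℝ≥0∞}
    (hc : ∀ i j : Fin (K + 1), i < j →
      LowerSemicontinuousOn (fun p : Y i × Y j => c i j p.1 p.2) ((D i)ᶜ ×ˢ (D j)ᶜ)) :
    LowerSemicontinuous (pathCost D c) := by
  refine lowerSemicontinuous_sum fun i _ => lowerSemicontinuous_sum fun j _ => ?_
  intro ω y hy
  simp only [gt_iff_lt] at hy ⊢
  by_cases h : i < j ∧ ω i ∉ D i ∧ ω j ∉ D j ∧ ∀ m, i < m → m < j → ω m ∈ D m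
  · rw [if_pos h] at hy
    obtain ⟨hij, hi, hj, hm⟩ := h
    have hi' : ∀ᶠ ω' in 𝓝 ω, ω' i ∉ D i :=
      (continuous_apply i).continuousAt.eventually ((hDclosed i).isOpen_compl.mem_nhds hi)
    have hj' : ∀ᶠ ω' in 𝓝 ω, ω' j ∉ D j :=
      (continuous_apply j).continuousAt.eventually ((hDclosed j).isOpen_compl.mem_nhds hj)
    have hm' : ∀ᶠ ω' in 𝓝 ω, ∀ m, i < m → m < j → ω' m ∈ D m := by
      simp only [eventually_all]
      exact fun m h₁ h₂ =>
        (continuous_apply m).continuousAt.eventually ((hDopen m).mem_nhds (hm m h₁ h₂))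
    have hlt : ∀ᶠ p in 𝓝 (ω i, ω j), y < c i j p.1 p.2 := by
      have hmem : (ω i, ω j) ∈ (D i)ᶜ ×ˢ (D j)ᶜ := ⟨hi, hj⟩
      have hwithin := hc i j hij (ω i, ω j) hmem y hy
      rwa [((hDclosed i).isOpen_compl.prod (hDclosed j).isOpen_compl).nhdsWithin_eq
        hmem] at hwithin
    have hcont : Continuous fun ω' : ∀ k, Y k => (ω' i, ω' j) := by fun_prop
    filter_upwards [hi', hj', hm', hcont.continuousAt.eventually hlt] with ω' h₁ h₂ h₃ h₄
    rwa [if_pos ⟨hij, h₁, h₂, h₃⟩]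
  · simp [if_neg h] at hy

/-- **existence of a Kantorovich solution.** Fix `μ₀ ∈ P(X₀)`,
`μ_K ∈ P(X_K)` and suppose `M < ∞`. Suppose moreover that there is a minimizing sequence
`{πₙ}` for `M` and a measurable `Φ : Ω → [0,∞]` whose sublevel sets `{Φ ≤ R}` (`R > 0`)
are compact and with `sup_n ∫ Φ dπₙ < ∞`. Then the infimum `M` is attained: there exist
intermediate measures `μₖ* ∈ P(X̂ₖ)` and an optimal coupling
`π* ∈ Π(μ₀, μ₁*, …, μ_{K−1}*, μ_K)` with `∫ c dπ* = M` (the `μₖ*` being the marginals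
`(Tₖ)_# π*`). -/
theorem hjmot_exists_minimizer {K : ℕ} (hK : 1 ≤ K)
    (Y : Fin (K + 1) → Type*) [∀ k, TopologicalSpace (Y k)] [∀ k, PolishSpace (Y k)]
    [∀ k, MeasurableSpace (Y k)] [∀ k, BorelSpace (Y k)]
    (D : ∀ k, Set (Y k))
    (hDopen : ∀ k, IsOpen (D k)) (hDsub : ∀ k, (D k).Subsingleton)
    (hD0 : D 0 = ∅) (hDK : D (Fin.last K) = ∅)
    (c : ∀ i j : Fin (K + 1), Y i → Y j → ℝ≥0∞)
    (hc : ∀ i j : Fin (K + 1), i < j →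
      LowerSemicontinuousOn (fun p : Y i × Y j => c i j p.1 p.2) ((D i)ᶜ ×ˢ (D j)ᶜ))
    (μ0 : Measure (Y 0)) (μK : Measure (Y (Fin.last K)))
    [IsProbabilityMeasure μ0] [IsProbabilityMeasure μK]
    (hM : hjmotValue D c μ0 μK < ∞)
    (πs : ℕ → Measure (∀ k, Y k)) (hπs : ∀ n, πs n ∈ hjmotAdm μ0 μK)
    (hmin : Tendsto (fun n => ∫⁻ ω, pathCost D c ω ∂(πs n)) atTop
      (nhds (hjmotValue D c μ0 μK)))
    (Φ : (∀ k, Y k) → ℝ≥0∞) (hΦmeas : Measurable Φ)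
    (hΦcomp : ∀ R : ℝ≥0, 0 < R → IsCompact {ω : ∀ k, Y k | Φ ω ≤ (R : ℝ≥0∞)})
    (hΦbdd : (⨆ n, ∫⁻ ω, Φ ω ∂(πs n)) < ∞) :
    ∃ πstar : Measure (∀ k, Y k), πstar ∈ hjmotAdm μ0 μK ∧
      ∫⁻ ω, pathCost D c ω ∂πstar = hjmotValue D c μ0 μK := by
  have : ∀ n, IsProbabilityMeasure (πs n) := fun n => (hπs n).1
  have hlsc : LowerSemicontinuous (pathCost D c) :=
    lowerSemicontinuous_pathCost hDopen (fun k => (hDsub k).isClosed) hc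
  let P : ℕ → ProbabilityMeasure (∀ k, Y k) := fun n => ⟨πs n, inferInstance⟩
  have htight : IsTightMeasureSet
      {((μ : ProbabilityMeasure (∀ k, Y k)) : Measure (∀ k, Y k)) | μ ∈ range P} := by
    refine isTightMeasureSet_of_lintegral_le hΦmeas hΦcomp hΦbdd.ne ?_
    rintro _ ⟨_, ⟨n, rfl⟩, rfl⟩
    exact le_iSup (fun n => ∫⁻ ω, Φ ω ∂(πs n)) n
  obtain ⟨Q, -, φ, hφ, hQ⟩ := (isCompact_closure_of_isTightMeasureSet htight).tendsto_subseq
    fun n => subset_closure (mem_range_self n)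
  have hmarg : ∀ (k : Fin (K + 1)) (μ : Measure (Y k)) [IsProbabilityMeasure μ],
      (∀ n, (πs n).map (fun ω => ω k) = μ) →
      (Q : Measure (∀ k, Y k)).map (fun ω => ω k) = μ := by
    intro k μ _ h
    have hlim := ProbabilityMeasure.tendsto_map_of_tendsto_of_continuous _ _ hQ
      (continuous_apply k)
    let ν : ProbabilityMeasure (Y k) := ⟨μ, inferInstance⟩
    have hconst : ∀ n, ((P ∘ φ) n).map (continuous_apply k).measurable.aemeasurable = ν := fun n =>
      Subtype.ext (h (φ n))
    simp only [hconst] at hlim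
    have heq := tendsto_nhds_unique hlim tendsto_const_nhds
    exact congrArg ProbabilityMeasure.toMeasure heq
  have hadm : (Q : Measure (∀ k, Y k)) ∈ hjmotAdm μ0 μK :=
    ⟨inferInstance, hmarg 0 μ0 fun n => (hπs n).2.1,
      hmarg (Fin.last K) μK fun n => (hπs n).2.2⟩
  refine ⟨Q, hadm, le_antisymm ?_ (iInf₂_le _ hadm)⟩
  have hle := hlsc.lintegral_le_liminf_lintegral (μ := Q) (μs := fun n => πs (φ n))
    fun G hG => ProbabilityMeasure.le_liminf_measure_open_of_tendsto hQ hG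
  exact hle.trans_eq (hmin.comp hφ.tendsto_atTop).liminf_eq
end

section
/- Fix μ_0 ∈ P(X_0) and μ_K ∈ P(X_K), and let {π^*, {μ_k^*}_{k=1}^{K−1}} be the unique minimizer of the hierarchical jump multi-marginal transport problem, with μ_0^* := μ_0 and μ_K^* := μ_K. Suppose ĉ_{i,i+1} : X̂_i × X̂_{i+1} → [0,∞] (i = 0, …, K−1) are Borel functions such that c(ω) ≤ Σ_{i=0}^{K−1} ĉ_{i,i+1}(x̂_i, x̂_{i+1}) for all ω = (x̂_0, …, x̂_K) ∈ Ω and c(ω) = Σ_{i=0}^{K−1} ĉ_{i,i+1}(x̂_i, x̂_{i+1}) for π^*-almost every ω. Then M = Σ_{i=0}^{K−1} Ĉ_{i,i+1}(μ_i^*, μ_{i+1}^*), where Ĉ_{i,i+1}(μ_i^*, μ_{i+1}^*) := inf_{π_i ∈ Π(μ_i^*, μ_{i+1}^*)} ∫_{X̂_i × X̂_{i+1}} ĉ_{i,i+1}(x̂_i, x̂_{i+1}) dπ_i is the two-marginal optimal transport cost. -/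
open MeasureTheory Filter Topology Set
open scoped ENNReal NNReal Classical

/-- The two-marginal optimal transport cost `inf_{γ ∈ Π(μ,ν)} ∫ cost dγ`. -/
noncomputable def otCost {A B : Type*} [MeasurableSpace A] [MeasurableSpace B]
    (cost : A → B → ℝ≥0∞) (μ : Measure A) (ν : Measure B) : ℝ≥0∞ :=
  ⨅ (γ : Measure (A × B)) (_ : γ.map Prod.fst = μ) (_ : γ.map Prod.snd = ν),
    ∫⁻ p, cost p.1 p.2 ∂γ

theorem map_prodMap_compProd_comap {A B C : Type*} [MeasurableSpace A] [MeasurableSpace B]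
    [MeasurableSpace C] (μ : Measure A) [SFinite μ] (κ : ProbabilityTheory.Kernel B C)
    [ProbabilityTheory.IsSFiniteKernel κ] {f : A → B} (hf : Measurable f) :
    (μ.compProd (κ.comap f hf)).map (Prod.map f id) = (μ.map f).compProd κ := by
  ext s hs
  rw [Measure.map_apply (hf.prodMap measurable_id) hs,
    Measure.compProd_apply (hf.prodMap measurable_id hs), Measure.compProd_apply hs,
    lintegral_map (ProbabilityTheory.Kernel.measurable_kernel_prodMk_left hs) hf]
  rfl

/-- Gluing of a chain of couplings with compatible marginals. -/
theorem exists_gluing {K : ℕ} (Y : Fin (K + 1) → Type*) [∀ k, MeasurableSpace (Y k)]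
    [∀ k, StandardBorelSpace (Y k)] (μ : ∀ k, Measure (Y k)) [∀ k, IsProbabilityMeasure (μ k)]
    (γ : ∀ i : Fin K, Measure (Y i.castSucc × Y i.succ))
    (hfst : ∀ i, (γ i).map Prod.fst = μ i.castSucc)
    (hsnd : ∀ i, (γ i).map Prod.snd = μ i.succ) :
    ∃ π : Measure (∀ k, Y k), (∀ k, π.map (fun ω => ω k) = μ k) ∧
      ∀ i : Fin K, π.map (fun ω => (ω i.castSucc, ω i.succ)) = γ i := by
  induction K with
  | zero =>
    refine ⟨Measure.pi μ, fun k => (measurePreserving_eval μ k).map_eq, fun i => i.elim0⟩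
  | succ K ih =>
    obtain ⟨π, hπ, hπγ⟩ := ih (fun k => Y k.succ) (fun k => μ k.succ) (fun i => γ i.succ)
      (fun i => hfst i.succ) (fun i => hsnd i.succ)
    have hprob : IsProbabilityMeasure π := by
      have : IsProbabilityMeasure (π.map fun ω => ω 0) := by rw [hπ]; infer_instance
      exact Measure.isProbabilityMeasure_of_map (fun ω => ω 0)
    have hγ : IsProbabilityMeasure (γ 0) := by
      have : IsProbabilityMeasure ((γ 0).map Prod.fst) := by rw [hfst]; infer_instance
      exact Measure.isProbabilityMeasure_of_map Prod.fst
    have : Nonempty (Y (Fin.castSucc (0 : Fin (K + 1)))) :=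
      (μ (Fin.castSucc (0 : Fin (K + 1)))).nonempty_of_neZero
    let ρ : Measure (Y (Fin.succ (0 : Fin (K + 1))) × Y (Fin.castSucc (0 : Fin (K + 1)))) :=
      (γ 0).map Prod.swap
    have hρ : IsProbabilityMeasure ρ :=
      Measure.isProbabilityMeasure_map measurable_swap.aemeasurable
    have hev : Measurable fun ω : ∀ k : Fin (K + 1), Y k.succ => ω 0 := measurable_pi_apply 0
    let σ := π.compProd (ρ.condKernel.comap _ hev)
    let glue : (∀ k : Fin (K + 1), Y k.succ) × Y (Fin.castSucc (0 : Fin (K + 1))) → ∀ k, Y k :=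
      fun p => Fin.cons p.2 p.1
    have hglue : Measurable glue := by
      refine measurable_pi_iff.2 fun k => ?_
      refine Fin.cases ?_ (fun j => ?_) k
      · exact measurable_snd
      · exact (measurable_pi_apply j).comp measurable_fst
    have hσfst : σ.map Prod.fst = π := Measure.fst_compProd _ _
    have hpair : σ.map (fun p => (p.2, p.1 0)) = γ 0 := by
      have h1 : σ.map (Prod.map (fun ω => ω 0) id) = ρ := by
        rw [map_prodMap_compProd_comap, hπ]
        have : μ (Fin.succ 0) = ρ.fst := by
          rw [← hsnd 0, Measure.fst, Measure.map_map measurable_fst measurable_swap]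
          rfl
        rw [this, Measure.disintegrate]
      have h2 : (fun p : (∀ k : Fin (K + 1), Y k.succ) × Y (Fin.castSucc (0 : Fin (K + 1))) =>
          (p.2, p.1 0)) = Prod.swap ∘ Prod.map (fun ω => ω 0) id := rfl
      rw [h2, ← Measure.map_map measurable_swap (hev.prodMap measurable_id), h1,
        Measure.map_map measurable_swap measurable_swap, Prod.swap_swap_eq, Measure.map_id]
    refine ⟨σ.map glue, fun k => ?_, fun i => ?_⟩
    · rw [Measure.map_map (measurable_pi_apply k) hglue]
      refine Fin.cases ?_ (fun j => ?_) k
      · have h := hfst 0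
        rw [← hpair, Measure.map_map measurable_fst
          (by fun_prop)] at h
        exact h
      · rw [← hπ j, ← hσfst, Measure.map_map (measurable_pi_apply j) measurable_fst]
        rfl
    · rw [Measure.map_map ((measurable_pi_apply _).prodMk (measurable_pi_apply _)) hglue]
      refine Fin.cases ?_ (fun j => ?_) i
      · exact hpair
      · rw [← hπγ j, ← hσfst, Measure.map_map
          ((measurable_pi_apply _).prodMk (measurable_pi_apply _)) measurable_fst]
        rfl

/-- Fix `μ₀ ∈ P(X₀)`, `μ_K ∈ P(X_K)`, and let `{π*, {μₖ*}}` be the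
unique minimizer of the hierarchical jump multi-marginal transport problem (with
`μₖ* = (Tₖ)_# π*`). Suppose the Borel functions `ĉ_{i,i+1} : X̂ᵢ × X̂_{i+1} → [0,∞]`
satisfy `c(ω) ≤ Σᵢ ĉ_{i,i+1}(x̂ᵢ, x̂_{i+1})` for all `ω ∈ Ω`, with equality `π*`-a.e.
Then `M = Σ_{i=0}^{K−1} Ĉ_{i,i+1}(μᵢ*, μ_{i+1}*)`, where `Ĉ_{i,i+1}` denotes the
two-marginal optimal transport cost with cost `ĉ_{i,i+1}`. -/
theorem hjmotValue_eq_sum_otCost {K : ℕ} (hK : 1 ≤ K)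
    (Y : Fin (K + 1) → Type*) [∀ k, TopologicalSpace (Y k)] [∀ k, PolishSpace (Y k)]
    [∀ k, MeasurableSpace (Y k)] [∀ k, BorelSpace (Y k)]
    (D : ∀ k, Set (Y k))
    (hDopen : ∀ k, IsOpen (D k)) (hDsub : ∀ k, (D k).Subsingleton)
    (hD0 : D 0 = ∅) (hDK : D (Fin.last K) = ∅)
    (c : ∀ i j : Fin (K + 1), Y i → Y j → ℝ≥0∞)
    (hc : ∀ i j : Fin (K + 1), i < j →
      LowerSemicontinuousOn (fun p : Y i × Y j => c i j p.1 p.2) ((D i)ᶜ ×ˢ (D j)ᶜ))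
    (μ0 : Measure (Y 0)) (μK : Measure (Y (Fin.last K)))
    [IsProbabilityMeasure μ0] [IsProbabilityMeasure μK]
    (πstar : Measure (∀ k, Y k)) (hadm : πstar ∈ hjmotAdm μ0 μK)
    (hopt : ∫⁻ ω, pathCost D c ω ∂πstar = hjmotValue D c μ0 μK)
    (huniq : ∀ π' ∈ hjmotAdm μ0 μK,
      ∫⁻ ω, pathCost D c ω ∂π' = hjmotValue D c μ0 μK → π' = πstar)
    (chat : ∀ i : Fin K, Y i.castSucc → Y i.succ → ℝ≥0∞)
    (hchatmeas : ∀ i : Fin K,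
      Measurable (fun p : Y i.castSucc × Y i.succ => chat i p.1 p.2))
    (hle : ∀ ω : ∀ k, Y k,
      pathCost D c ω ≤ ∑ i : Fin K, chat i (ω i.castSucc) (ω i.succ))
    (heq : ∀ᵐ ω ∂πstar,
      pathCost D c ω = ∑ i : Fin K, chat i (ω i.castSucc) (ω i.succ)) :
    hjmotValue D c μ0 μK = ∑ i : Fin K,
      otCost (chat i) (πstar.map (fun ω => ω i.castSucc))
        (πstar.map (fun ω => ω i.succ)) := by
  have hprob : IsProbabilityMeasure πstar := hadm.1
  have hev : ∀ k, Measurable fun ω : ∀ k, Y k => ω k := measurable_pi_apply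
  have hint : ∀ π : Measure (∀ k, Y k),
      ∫⁻ ω, ∑ i : Fin K, chat i (ω i.castSucc) (ω i.succ) ∂π =
        ∑ i : Fin K, ∫⁻ p, chat i p.1 p.2 ∂(π.map fun ω => (ω i.castSucc, ω i.succ)) := by
    intro π
    refine (lintegral_finsetSum _ fun i _ =>
      (hchatmeas i).comp ((hev i.castSucc).prodMk (hev i.succ))).trans ?_
    exact Finset.sum_congr rfl fun i _ =>
      (lintegral_map (hchatmeas i) ((hev i.castSucc).prodMk (hev i.succ))).symm
  apply le_antisymm
  · refine ENNReal.le_of_forall_pos_le_add fun ε hε hfin => ?_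
    have hδ : (ε / K : ℝ≥0∞) ≠ 0 :=
      (ENNReal.div_pos (by exact_mod_cast hε.ne') (ENNReal.natCast_ne_top K)).ne'
    have hex : ∀ i : Fin K, ∃ γ : Measure (Y i.castSucc × Y i.succ),
        γ.map Prod.fst = πstar.map (fun ω => ω i.castSucc) ∧
        γ.map Prod.snd = πstar.map (fun ω => ω i.succ) ∧
        ∫⁻ p, chat i p.1 p.2 ∂γ ≤ otCost (chat i) (πstar.map (fun ω => ω i.castSucc))
          (πstar.map (fun ω => ω i.succ)) + ε / K := by
      intro i
      have hlt := ENNReal.lt_add_right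
        (ENNReal.sum_ne_top.1 hfin.ne i (Finset.mem_univ i)) hδ
      conv at hlt => lhs; unfold otCost
      simp only [iInf_lt_iff] at hlt
      obtain ⟨γ, h1, h2, h3⟩ := hlt
      exact ⟨γ, h1, h2, h3.le⟩
    choose γ hfst hsnd hγ using hex
    have hmarg : ∀ k, IsProbabilityMeasure (πstar.map fun ω => ω k) := fun k =>
      Measure.isProbabilityMeasure_map (hev k).aemeasurable
    obtain ⟨π, hπ, hπγ⟩ := exists_gluing Y (fun k => πstar.map fun ω => ω k) γ hfst hsnd
    have hπprob : IsProbabilityMeasure π := by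
      have : IsProbabilityMeasure (π.map fun ω => ω 0) := by rw [hπ]; infer_instance
      exact Measure.isProbabilityMeasure_of_map (fun ω => ω 0)
    have hπadm : π ∈ hjmotAdm μ0 μK :=
      ⟨hπprob, (hπ 0).trans hadm.2.1, (hπ (Fin.last K)).trans hadm.2.2⟩
    have hK0 : (K : ℝ≥0∞) ≠ 0 := by exact_mod_cast (by omega : K ≠ 0)
    calc hjmotValue D c μ0 μK ≤ ∫⁻ ω, pathCost D c ω ∂π := iInf₂_le π hπadm
      _ ≤ ∫⁻ ω, ∑ i : Fin K, chat i (ω i.castSucc) (ω i.succ) ∂π := lintegral_mono hle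
      _ = ∑ i : Fin K, ∫⁻ p, chat i p.1 p.2 ∂(γ i) := by simp only [hint, hπγ]
      _ ≤ ∑ i : Fin K, (otCost (chat i) (πstar.map (fun ω => ω i.castSucc))
          (πstar.map (fun ω => ω i.succ)) + ε / K) := Finset.sum_le_sum fun i _ => hγ i
      _ = _ := by
        rw [Finset.sum_add_distrib, Finset.sum_const, Finset.card_univ, Fintype.card_fin,
          nsmul_eq_mul, ENNReal.mul_div_cancel hK0 (ENNReal.natCast_ne_top K)]
  · rw [← hopt, lintegral_congr_ae heq, hint]
    refine Finset.sum_le_sum fun i _ => ?_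
    have hp := (hev i.castSucc).prodMk (hev i.succ)
    exact iInf_le_of_le _ (iInf_le_of_le (Measure.map_map measurable_fst hp)
      (iInf_le_of_le (Measure.map_map measurable_snd hp) le_rfl))
end
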